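/- Let K be a convex body in R^{n+1} and for ξ in the interior of K define H(ξ) = ∫_{S^n} (h_K(x) - ⟨ξ, x⟩)^p dσ(x) with p < -n-1. Then H is strictly convex on int K, H(ξ) → ∞ as ξ → ∂K, and hence H attains its infimum at a unique interior point ξ_K (the Blaschke-Santaló center), characterized by ∫_{S^n} x (h_K(x) - ⟨ξ_K, x⟩)^{p-1} dσ(x) = 0. -/

import Mathlib

open MeasureTheory Real Set Filter
open scoped RealInnerProductSpace Topology

noncomputable section

abbrev Euc (n : ℕ) : Type := EuclideanSpace ℝ (Fin (n + 1))

def sphMeas (n : ℕ) : Measure (Euc n) :=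
  (μH[n] : Measure (Euc n)).restrict (Metric.sphere (0 : Euc n) 1)

lemma isAddHaarMeasure_hausdorffMeasure_orthogonal {n : ℕ} {v : Euc n} (hv : ‖v‖ = 1) :
    (μH[n] : Measure (ℝ ∙ v)ᗮ).IsAddHaarMeasure := by
  have : Fact (Module.finrank ℝ (Euc n) = n + 1) := ⟨by simp⟩
  have hv0 : v ≠ 0 := by
    rintro rfl
    simp at hv
  have := isAddHaarMeasure_hausdorffMeasure (E := (ℝ ∙ v)ᗮ)
  rwa [Submodule.finrank_orthogonal_span_singleton (n := n) hv0] at this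

lemma norm_coe_stereoToFun_le {n : ℕ} {v x : Euc n} (hx : ‖x‖ = 1) (hvx : ⟪v, x⟫ ≤ 0) :
    ‖stereoToFun v x‖ ≤ 2 := by
  rw [stereoToFun_apply, norm_smul, innerSL_apply_apply, Real.norm_of_nonneg (by
    apply div_nonneg <;> linarith)]
  have h1 : 2 / (1 - ⟪v, x⟫) ≤ 2 := by
    rw [div_le_iff₀ (by linarith)]
    linarith
  have h2 : ‖(ℝ ∙ v)ᗮ.orthogonalProjectionOnto x‖ ≤ 1 :=
    hx ▸ (ℝ ∙ v)ᗮ.norm_orthogonalProjectionOnto_apply_le x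
  calc _ ≤ (2 : ℝ) * 1 := by gcongr
    _ = 2 := by norm_num

/-- The closed hemisphere centred at `-v` has finite surface measure, as it is the image of a ball
under inverse stereographic projection. -/
lemma hausdorffMeasure_hemisphere_lt_top {n : ℕ} {v : Euc n} (hv : ‖v‖ = 1) :
    (μH[n] : Measure (Euc n)) {x | ‖x‖ = 1 ∧ ⟪v, x⟫ ≤ 0} < ⊤ := by
  have := isAddHaarMeasure_hausdorffMeasure_orthogonal hv
  set f : (ℝ ∙ v)ᗮ → Euc n := fun w => stereoInvFunAux v w with hf
  have hfd : ContDiff ℝ 1 f := contDiff_stereoInvFunAux.comp (ℝ ∙ v)ᗮ.subtypeL.contDiff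
  obtain ⟨C, hC⟩ := hfd.contDiffOn.exists_lipschitzOnWith (s := Metric.closedBall 0 2)
    one_ne_zero (convex_closedBall _ _) (isCompact_closedBall _ _)
  have hsub : {x : Euc n | ‖x‖ = 1 ∧ ⟪v, x⟫ ≤ 0} ⊆ f '' Metric.closedBall 0 2 := by
    rintro x ⟨hx, hvx⟩
    refine ⟨stereoToFun v x, by simpa using norm_coe_stereoToFun_le hx hvx, ?_⟩
    have hxv : x ≠ v := by
      rintro rfl
      rw [real_inner_self_eq_norm_sq, hx] at hvx
      norm_num at hvx
    exact congrArg Subtype.val (stereo_left_inv hv (x := ⟨x, by simpa using hx⟩) hxv)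
  calc _ ≤ μH[n] (f '' Metric.closedBall 0 2) := measure_mono hsub
    _ ≤ (C : ENNReal) ^ (n : ℝ) * μH[n] (Metric.closedBall (0 : (ℝ ∙ v)ᗮ) 2) :=
      hC.hausdorffMeasure_image_le (by positivity)
    _ < ⊤ := ENNReal.mul_lt_top (ENNReal.rpow_lt_top_of_nonneg (by positivity) (by simp))
      (isCompact_closedBall _ _).measure_lt_top

instance isFiniteMeasure_sphMeas (n : ℕ) : IsFiniteMeasure (sphMeas n) := by
  refine ⟨?_⟩
  rw [sphMeas, Measure.restrict_apply_univ]
  obtain ⟨v, hv⟩ : ∃ v : Euc n, ‖v‖ = 1 := ⟨EuclideanSpace.single 0 1, by simp⟩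
  refine (measure_mono (t := {x | ‖x‖ = 1 ∧ ⟪v, x⟫ ≤ 0} ∪ {x | ‖x‖ = 1 ∧ ⟪-v, x⟫ ≤ 0})
    ?_).trans_lt (measure_union_lt_top (hausdorffMeasure_hemisphere_lt_top hv)
      (hausdorffMeasure_hemisphere_lt_top (by simpa using hv)))
  intro x hx
  have hx' : ‖x‖ = 1 := by simpa using hx
  rcases le_total ⟪v, x⟫ 0 with h | h
  · exact Or.inl ⟨hx', h⟩
  · exact Or.inr ⟨hx', by simpa using h⟩

/-- Spherical caps of radius `r` have measure at least a constant times `r ^ n`. -/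
lemma exists_le_sphMeas_closedBall {n : ℕ} {v : Euc n} (hv : ‖v‖ = 1) :
    ∃ c : ℝ, 0 < c ∧ ∀ r, 0 < r → r ≤ 1 →
      c * r ^ n ≤ (sphMeas n).real (Metric.closedBall v r) := by
  have := isAddHaarMeasure_hausdorffMeasure_orthogonal hv
  have : Fact (Module.finrank ℝ (Euc n) = n + 1) := ⟨by simp⟩
  have hv0 : v ≠ 0 := by
    rintro rfl
    simp at hv
  set μ : Measure (ℝ ∙ v)ᗮ := μH[n]
  refine ⟨μ.real (Metric.ball 0 (1 / 2)), ?_, fun r hr hr1 => ?_⟩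
  · exact ENNReal.toReal_pos (Metric.measure_ball_pos _ _ (by norm_num)).ne'
      measure_ball_lt_top.ne
  set P := (ℝ ∙ v)ᗮ.orthogonalProjectionOnto with hP
  have hlip : LipschitzWith 1 P :=
    P.lipschitz.weaken (by exact_mod_cast (ℝ ∙ v)ᗮ.orthogonalProjectionOnto_norm_le)
  have hsub : Metric.ball 0 (r * (1 / 2)) ⊆
      P '' (Metric.closedBall v r ∩ Metric.sphere (0 : Euc n) 1) := by
    intro w hw
    have hw' : ‖(w : Euc n)‖ < r * (1 / 2) := by simpa using hw
    have horth : ⟪v, (w : Euc n)⟫ = 0 := Submodule.mem_orthogonal_singleton_iff_inner_right.mp w.2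
    have hn0 := norm_nonneg (w : Euc n)
    set s := √(1 - ‖(w : Euc n)‖ ^ 2) with hs
    have hs0 : 0 ≤ s := sqrt_nonneg _
    have hs2 : s ^ 2 = 1 - ‖(w : Euc n)‖ ^ 2 := sq_sqrt (by nlinarith)
    refine ⟨w + s • v, ⟨?_, ?_⟩, ?_⟩
    · rw [mem_closedBall_iff_norm]
      have e : (w : Euc n) + s • v - v = w + (s - 1) • v := by module
      rw [e]
      refine le_of_sq_le_sq ?_ hr.le
      rw [norm_add_sq_real, inner_smul_right, real_inner_comm, horth, norm_smul, hv]
      simp only [Real.norm_eq_abs, mul_one, sq_abs]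
      nlinarith
    · rw [mem_sphere_zero_iff_norm, ← sq_eq_sq₀ (norm_nonneg _) zero_le_one]
      rw [norm_add_sq_real, inner_smul_right, real_inner_comm, horth, norm_smul, hv]
      simp only [Real.norm_eq_abs, mul_one, sq_abs]
      linarith
    · rw [map_add, map_smul, hP,
        Submodule.orthogonalProjectionOnto_orthogonalComplement_singleton_eq_zero,
        Submodule.orthogonalProjectionOnto_mem_subspace_eq_self]
      simp
  have key : μ (Metric.ball 0 (r * (1 / 2))) ≤ sphMeas n (Metric.closedBall v r) := by
    rw [sphMeas, Measure.restrict_apply Metric.isClosed_closedBall.measurableSet]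
    refine (measure_mono hsub).trans ?_
    simpa using hlip.hausdorffMeasure_image_le (d := n) (by positivity)
      (Metric.closedBall v r ∩ Metric.sphere (0 : Euc n) 1)
  rw [Measure.addHaar_ball_mul_of_pos _ _ hr,
    Submodule.finrank_orthogonal_span_singleton (n := n) hv0] at key
  have := ENNReal.toReal_mono (measure_ne_top _ _) key
  rw [ENNReal.toReal_mul, ENNReal.toReal_ofReal (by positivity)] at this
  rw [mul_comm]
  exact this

lemma ae_sphMeas_norm_eq_one (n : ℕ) : ∀ᵐ x ∂sphMeas n, ‖x‖ = 1 := by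
  filter_upwards [ae_restrict_mem Metric.isClosed_sphere.measurableSet] with x hx
  simpa using hx

lemma strictConvexOn_rpow_of_neg {p : ℝ} (hp : p < 0) :
    StrictConvexOn ℝ (Ioi 0) fun x : ℝ => x ^ p := by
  refine ⟨convex_Ioi 0, fun x hx y hy hxy a b ha hb hab => ?_⟩
  have hx : 0 < x := hx
  have hy : 0 < y := hy
  have hlog := strictConcaveOn_log_Ioi.2 hx hy hxy ha hb hab
  have hexp := convexOn_exp.2 (mem_univ (log x * p)) (mem_univ (log y * p)) ha.le hb.le hab
  simp only [smul_eq_mul] at *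
  rw [rpow_def_of_pos hx, rpow_def_of_pos hy, rpow_def_of_pos (by positivity)]
  refine lt_of_lt_of_le (exp_lt_exp.2 ?_) hexp
  nlinarith

section SupportFunction

variable {n : ℕ} {K : Set (Euc n)} {h : Euc n → ℝ}

lemma inner_le_of_supp (hK : IsCompact K) (hsupp : ∀ y, h y = sSup ((fun z => ⟪z, y⟫) '' K))
    {z : Euc n} (hz : z ∈ K) (y : Euc n) : ⟪z, y⟫ ≤ h y := by
  rw [hsupp]
  exact le_csSup (hK.image (by fun_prop)).bddAbove (mem_image_of_mem _ hz)

lemma exists_supp_eq_inner (hK : IsCompact K) (hne : K.Nonempty)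
    (hsupp : ∀ y, h y = sSup ((fun z => ⟪z, y⟫) '' K)) (y : Euc n) : ∃ z ∈ K, h y = ⟪z, y⟫ := by
  rw [hsupp]
  exact hK.exists_sSup_image_eq hne (by fun_prop)

lemma exists_lipschitzWith_supp (hK : IsCompact K) (hne : K.Nonempty)
    (hsupp : ∀ y, h y = sSup ((fun z => ⟪z, y⟫) '' K)) : ∃ C, LipschitzWith C h := by
  obtain ⟨R, hR0, hR⟩ := hK.isBounded.exists_pos_norm_le
  refine ⟨R.toNNReal, LipschitzWith.of_le_add_mul _ fun x y => ?_⟩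
  obtain ⟨z, hz, hzx⟩ := exists_supp_eq_inner hK hne hsupp x
  have h1 := inner_le_of_supp hK hsupp hz y
  have h2 : ⟪z, x - y⟫ ≤ R * ‖x - y‖ := (real_inner_le_norm _ _).trans (by gcongr; exact hR z hz)
  rw [inner_sub_right] at h2
  rw [dist_eq_norm, coe_toNNReal R hR0.le]
  linarith

lemma le_supp_sub_inner (hK : IsCompact K) (hsupp : ∀ y, h y = sSup ((fun z => ⟪z, y⟫) '' K))
    {ξ : Euc n} {r : ℝ} (hr : 0 ≤ r) (hξ : Metric.closedBall ξ r ⊆ K) {x : Euc n} (hx : ‖x‖ = 1) :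
    r ≤ h x - ⟪ξ, x⟫ := by
  have hmem : ξ + r • x ∈ K := hξ (by simp [norm_smul, hx, abs_of_nonneg hr])
  have := inner_le_of_supp hK hsupp hmem x
  rw [inner_add_left, inner_smul_left, real_inner_self_eq_norm_sq, hx] at this
  simp at this
  linarith

lemma exists_closedBall_subset_of_mem_interior {ξ : Euc n} (hξ : ξ ∈ interior K) :
    ∃ r, 0 < r ∧ Metric.closedBall ξ r ⊆ K :=
  Metric.nhds_basis_closedBall.mem_iff.1 (mem_interior_iff_mem_nhds.1 hξ)

lemma supp_sub_inner_pos (hK : IsCompact K) (hsupp : ∀ y, h y = sSup ((fun z => ⟪z, y⟫) '' K))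
    {ξ : Euc n} (hξ : ξ ∈ interior K) {x : Euc n} (hx : ‖x‖ = 1) : 0 < h x - ⟪ξ, x⟫ := by
  obtain ⟨r, hr, hrK⟩ := exists_closedBall_subset_of_mem_interior hξ
  exact hr.trans_le (le_supp_sub_inner hK hsupp hr.le hrK hx)

lemma measurable_supp_sub_inner_rpow (hcont : Continuous h) (ξ : Euc n) (q : ℝ) :
    Measurable fun x => (h x - ⟪ξ, x⟫) ^ q :=
  (show Continuous fun x => h x - ⟪ξ, x⟫ by fun_prop).measurable.pow_const q

lemma integrable_supp_sub_inner_rpow (hK : IsCompact K) (hcont : Continuous h)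
    (hsupp : ∀ y, h y = sSup ((fun z => ⟪z, y⟫) '' K))
    {ξ : Euc n} (hξ : ξ ∈ interior K) {q : ℝ} (hq : q ≤ 0) :
    Integrable (fun x => (h x - ⟪ξ, x⟫) ^ q) (sphMeas n) := by
  obtain ⟨r, hr, hrK⟩ := exists_closedBall_subset_of_mem_interior hξ
  refine Integrable.of_bound (measurable_supp_sub_inner_rpow hcont ξ q).aestronglyMeasurable
    (r ^ q) ?_
  filter_upwards [ae_sphMeas_norm_eq_one n] with x hx
  have hle := le_supp_sub_inner hK hsupp hr.le hrK hx
  rw [norm_of_nonneg (rpow_nonneg (hr.le.trans hle) _)]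
  exact rpow_le_rpow_of_nonpos hr hle hq

lemma strictConvexOn_integral_supp (hK : IsCompact K) (hconv : Convex ℝ K) (hcont : Continuous h)
    (hsupp : ∀ y, h y = sSup ((fun z => ⟪z, y⟫) '' K)) {p : ℝ} (hp : p < 0) :
    StrictConvexOn ℝ (interior K) fun ξ => ∫ x, (h x - ⟪ξ, x⟫) ^ p ∂(sphMeas n) := by
  refine ⟨hconv.interior, fun ξ hξ η hη hne a b ha hb hab => ?_⟩
  have hζ : a • ξ + b • η ∈ interior K := hconv.interior hξ hη ha.le hb.le hab
  have hi := fun {ξ} (hξ : ξ ∈ interior K) =>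
    integrable_supp_sub_inner_rpow hK hcont hsupp hξ hp.le
  have haff : ∀ x : Euc n, h x - ⟪a • ξ + b • η, x⟫
      = a * (h x - ⟪ξ, x⟫) + b * (h x - ⟪η, x⟫) := by
    intro x
    rw [inner_add_left, real_inner_smul_left, real_inner_smul_left]
    linear_combination (-h x) * hab
  set g : Euc n → ℝ := fun x => a * (h x - ⟪ξ, x⟫) ^ p + b * (h x - ⟪η, x⟫) ^ p
    - (h x - ⟪a • ξ + b • η, x⟫) ^ p with hg
  have hsc := strictConvexOn_rpow_of_neg hp
  have hg0 : 0 ≤ᵐ[sphMeas n] g := by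
    filter_upwards [ae_sphMeas_norm_eq_one n] with x hx
    have := hsc.convexOn.2 (supp_sub_inner_pos hK hsupp hξ hx)
      (supp_sub_inner_pos hK hsupp hη hx) ha.le hb.le hab
    simp only [smul_eq_mul, ← haff] at this
    simpa [hg] using this
  have hgi : Integrable g (sphMeas n) :=
    (((hi hξ).const_mul a).add ((hi hη).const_mul b)).sub (hi hζ)
  have hd : 0 < ‖ξ - η‖ := norm_pos_iff.2 (sub_ne_zero.2 hne)
  obtain ⟨v, hv, hvd⟩ : ∃ v : Euc n, ‖v‖ = 1 ∧ ⟪ξ - η, v⟫ = ‖ξ - η‖ := by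
    refine ⟨‖ξ - η‖⁻¹ • (ξ - η), norm_smul_inv_norm (𝕜 := ℝ) (sub_ne_zero.2 hne), ?_⟩
    rw [inner_smul_right, real_inner_self_eq_norm_sq]
    field_simp
  have hcap : 0 < sphMeas n (Metric.closedBall v (1 / 2)) := by
    obtain ⟨c, hc, hcr⟩ := exists_le_sphMeas_closedBall hv
    have := hcr (1 / 2) (by norm_num) (by norm_num)
    exact ENNReal.toReal_pos_iff.1 (lt_of_lt_of_le (by positivity) this) |>.1
  have hpos : 0 < ∫ x, g x ∂(sphMeas n) := by
    rw [integral_pos_iff_support_of_nonneg_ae hg0 hgi]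
    refine hcap.trans_le (measure_mono_ae ?_)
    filter_upwards [ae_sphMeas_norm_eq_one n] with x hx (hxv : x ∈ Metric.closedBall v (1 / 2))
    have hin : 0 < ⟪ξ - η, x⟫ := by
      rw [mem_closedBall_iff_norm] at hxv
      have h1 : ⟪ξ - η, v - x⟫ ≤ ‖ξ - η‖ * (1 / 2) :=
        (real_inner_le_norm _ _).trans (by rw [norm_sub_rev v x]; gcongr)
      rw [inner_sub_right, hvd] at h1
      linarith
    rw [inner_sub_left] at hin
    have := hsc.2 (supp_sub_inner_pos hK hsupp hξ hx) (supp_sub_inner_pos hK hsupp hη hx)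
      (by intro he; linarith) ha hb hab
    simp only [smul_eq_mul, ← haff] at this
    exact (sub_pos.2 this).ne'
  have heq : ∫ x, g x ∂(sphMeas n) = a * ∫ x, (h x - ⟪ξ, x⟫) ^ p ∂(sphMeas n)
      + b * ∫ x, (h x - ⟪η, x⟫) ^ p ∂(sphMeas n)
      - ∫ x, (h x - ⟪a • ξ + b • η, x⟫) ^ p ∂(sphMeas n) := by
    have hadd : Integrable
        (fun x => a * (h x - ⟪ξ, x⟫) ^ p + b * (h x - ⟪η, x⟫) ^ p) (sphMeas n) :=
      ((hi hξ).const_mul a).add ((hi hη).const_mul b)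
    rw [integral_sub hadd (hi hζ), integral_add ((hi hξ).const_mul a) ((hi hη).const_mul b),
      integral_const_mul, integral_const_mul]
  simp only [smul_eq_mul]
  linarith

lemma exists_normal_of_mem_frontier (hconv : Convex ℝ K)
    (hint : (interior K).Nonempty) {ξ₀ : Euc n} (hξ₀ : ξ₀ ∈ frontier K) :
    ∃ v : Euc n, ‖v‖ = 1 ∧ ∀ z ∈ K, ⟪z, v⟫ ≤ ⟪ξ₀, v⟫ := by
  obtain ⟨f, hf⟩ := geometric_hahn_banach_open_point hconv.interior isOpen_interior hξ₀.2
  set w := (InnerProductSpace.toDual ℝ (Euc n)).symm f with hw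
  have hfw : ∀ z, f z = ⟪z, w⟫ := fun z => by
    rw [real_inner_comm, hw, InnerProductSpace.toDual_symm_apply]
  have hw0 : w ≠ 0 := by
    intro h0
    obtain ⟨z, hz⟩ := hint
    have := hf z hz
    simp [hfw, h0] at this
  have hle : ∀ z ∈ K, f z ≤ f ξ₀ := by
    intro z hz
    have hz' : z ∈ closure (interior K) := by
      rw [hconv.closure_interior_eq_closure_of_nonempty_interior hint]
      exact subset_closure hz
    exact closure_minimal (fun y hy => (hf y hy).le)
      (isClosed_le f.continuous continuous_const) hz'
  refine ⟨‖w‖⁻¹ • w, norm_smul_inv_norm (𝕜 := ℝ) hw0, fun z hz => ?_⟩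
  rw [inner_smul_right, inner_smul_right, ← hfw, ← hfw]
  exact mul_le_mul_of_nonneg_left (hle z hz) (by positivity)

lemma tendsto_integral_supp_atTop (hK : IsCompact K) (hconv : Convex ℝ K)
    (hint : (interior K).Nonempty) (hsupp : ∀ y, h y = sSup ((fun z => ⟪z, y⟫) '' K))
    {p : ℝ} (hp : p < -(n : ℝ)) {ξ₀ : Euc n} (hξ₀ : ξ₀ ∈ frontier K) :
    Tendsto (fun ξ => ∫ x, (h x - ⟪ξ, x⟫) ^ p ∂(sphMeas n)) (𝓝[interior K] ξ₀) atTop := by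
  have hp0 : p < 0 := hp.trans_le (by simp)
  have hne : K.Nonempty := hint.mono interior_subset
  obtain ⟨C, hC⟩ := exists_lipschitzWith_supp hK hne hsupp
  obtain ⟨v, hv, hvK⟩ := exists_normal_of_mem_frontier hconv hint hξ₀
  obtain ⟨c, hc, hcap⟩ := exists_le_sphMeas_closedBall hv
  have hhv : h v ≤ ⟪ξ₀, v⟫ := by
    obtain ⟨z, hz, hzv⟩ := exists_supp_eq_inner hK hne hsupp v
    exact hzv ▸ hvK z hz
  set B : ℝ := C + ‖ξ₀‖ + 1 with hB
  have hB0 : 0 < B := by positivity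
  have hbound : ∀ ξ ∈ interior K, ‖ξ - ξ₀‖ ≤ 1 → B ^ p * c * ‖ξ - ξ₀‖ ^ (p + n) ≤
      ∫ x, (h x - ⟪ξ, x⟫) ^ p ∂(sphMeas n) := by
    intro ξ hξ hr1
    have hr0 : 0 < ‖ξ - ξ₀‖ := norm_pos_iff.2 (sub_ne_zero.2 (by rintro rfl; exact hξ₀.2 hξ))
    set r := ‖ξ - ξ₀‖ with hr
    have hmark := mul_meas_ge_le_integral_of_nonneg (μ := sphMeas n)
      (f := fun x => (h x - ⟪ξ, x⟫) ^ p) (by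
        filter_upwards [ae_sphMeas_norm_eq_one n] with x hx
        exact rpow_nonneg (supp_sub_inner_pos hK hsupp hξ hx).le _)
      (integrable_supp_sub_inner_rpow hK hC.continuous hsupp hξ hp0.le) ((B * r) ^ p)
    have hsub : (sphMeas n).real (Metric.closedBall v r) ≤
        (sphMeas n).real {x | (B * r) ^ p ≤ (h x - ⟪ξ, x⟫) ^ p} := by
      refine ENNReal.toReal_mono (measure_ne_top _ _) (measure_mono_ae ?_)
      filter_upwards [ae_sphMeas_norm_eq_one n] with x hx (hxv : x ∈ Metric.closedBall v r)
      refine rpow_le_rpow_of_nonpos (supp_sub_inner_pos hK hsupp hξ hx) ?_ hp0.le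
      have hxv' : ‖x - v‖ ≤ r := mem_closedBall_iff_norm.1 hxv
      have h1 : h x ≤ h v + C * r := (hC.le_add_mul x v).trans (by rw [dist_eq_norm]; gcongr)
      have h2 : ⟪ξ₀, v - x⟫ ≤ ‖ξ₀‖ * r :=
        (real_inner_le_norm _ _).trans (by rw [norm_sub_rev v x]; gcongr)
      have h3 : ⟪ξ₀ - ξ, x⟫ ≤ r :=
        (real_inner_le_norm _ _).trans (by rw [norm_sub_rev, hx, mul_one])
      rw [inner_sub_right] at h2
      rw [inner_sub_left] at h3
      rw [hB]
      linarith
    calc B ^ p * c * r ^ (p + n) = (B * r) ^ p * (c * r ^ n) := by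
          rw [rpow_add hr0, rpow_natCast, mul_rpow hB0.le hr0.le]
          ring
      _ ≤ (B * r) ^ p * (sphMeas n).real {x | (B * r) ^ p ≤ (h x - ⟪ξ, x⟫) ^ p} := by
          gcongr
          exact (hcap r hr0 hr1).trans hsub
      _ ≤ _ := hmark
  have hdist : Tendsto (fun ξ => ‖ξ - ξ₀‖) (𝓝[interior K] ξ₀) (𝓝[>] 0) := by
    refine tendsto_nhdsWithin_iff.2 ⟨?_, ?_⟩
    · exact (by simpa using (show Continuous fun ξ => ‖ξ - ξ₀‖ by fun_prop).tendsto ξ₀ :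
        Tendsto (fun ξ => ‖ξ - ξ₀‖) (𝓝 ξ₀) (𝓝 0)).mono_left nhdsWithin_le_nhds
    · filter_upwards [self_mem_nhdsWithin] with ξ hξ
      exact norm_pos_iff.2 (sub_ne_zero.2 (by rintro rfl; exact hξ₀.2 hξ))
  refine tendsto_atTop_mono' _ ?_ (((tendsto_rpow_neg_nhdsGT_zero
    (y := p + n) (by linarith)).comp hdist).const_mul_atTop (by positivity : 0 < B ^ p * c))
  filter_upwards [self_mem_nhdsWithin,
    nhdsWithin_le_nhds (Metric.closedBall_mem_nhds ξ₀ one_pos)] with ξ hξ hξ1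
  exact hbound ξ hξ (mem_closedBall_iff_norm.1 hξ1)

lemma exists_isMinOn_integral_supp (hK : IsCompact K) (hconv : Convex ℝ K)
    (hint : (interior K).Nonempty) (hcont : Continuous h)
    (hsupp : ∀ y, h y = sSup ((fun z => ⟪z, y⟫) '' K)) {p : ℝ} (hp : p < -(n : ℝ)) :
    ∃ ξ ∈ interior K,
      IsMinOn (fun ζ => ∫ x, (h x - ⟪ζ, x⟫) ^ p ∂(sphMeas n)) (interior K) ξ := by
  have hp0 : p < 0 := hp.trans_le (by simp)
  set H : Euc n → ℝ := fun ζ => ∫ x, (h x - ⟪ζ, x⟫) ^ p ∂(sphMeas n) with hH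
  have hHc : ContinuousOn H (interior K) :=
    (strictConvexOn_integral_supp hK hconv hcont hsupp hp0).convexOn.continuousOn isOpen_interior
  obtain ⟨ξ₁, hξ₁⟩ := hint
  set S := {ξ ∈ interior K | H ξ ≤ H ξ₁} with hS
  have hSclosed : IsClosed S := by
    refine isClosed_of_closure_subset fun ξ hξ => ?_
    have hξK : ξ ∈ K :=
      closure_minimal (fun y hy => interior_subset hy.1) hK.isClosed hξ
    have : (𝓝[S] ξ).NeBot := mem_closure_iff_nhdsWithin_neBot.1 hξ
    have hmono : 𝓝[S] ξ ≤ 𝓝[interior K] ξ := nhdsWithin_mono _ fun y hy => hy.1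
    have hev : ∀ᶠ y in 𝓝[S] ξ, H y ≤ H ξ₁ := by
      filter_upwards [self_mem_nhdsWithin] with y hy using hy.2
    by_cases hξi : ξ ∈ interior K
    · exact ⟨hξi, le_of_tendsto ((hHc ξ hξi).tendsto.mono_left hmono) hev⟩
    · have ht := (tendsto_integral_supp_atTop hK hconv ⟨ξ₁, hξ₁⟩ hsupp hp
        (ξ₀ := ξ) ⟨subset_closure hξK, hξi⟩).mono_left hmono
      obtain ⟨y, hy1, hy2⟩ := ((ht.eventually_gt_atTop (H ξ₁)).and hev).exists
      exact absurd hy2 (not_le.2 hy1)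
  have hScompact : IsCompact S :=
    hK.of_isClosed_subset hSclosed fun y hy => interior_subset hy.1
  obtain ⟨ξ, hξ, hmin⟩ := hScompact.exists_isMinOn ⟨ξ₁, hξ₁, le_rfl⟩
    (hHc.mono fun y hy => hy.1)
  refine ⟨ξ, hξ.1, fun y hy => ?_⟩
  by_cases hy' : H y ≤ H ξ₁
  · exact hmin ⟨hy, hy'⟩
  · exact hξ.2.trans (not_le.1 hy').le

lemma hasDerivAt_integral_supp (hK : IsCompact K) (hcont : Continuous h)
    (hsupp : ∀ y, h y = sSup ((fun z => ⟪z, y⟫) '' K)) {p : ℝ} (hp : p ≤ 0)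
    {ξ : Euc n} (hξ : ξ ∈ interior K) (v : Euc n) :
    HasDerivAt (fun t : ℝ => ∫ x, (h x - ⟪ξ + t • v, x⟫) ^ p ∂(sphMeas n))
      (∫ x, -p * ((h x - ⟪ξ, x⟫) ^ (p - 1) * ⟪v, x⟫) ∂(sphMeas n)) 0 := by
  obtain ⟨r, hr, hrK⟩ := exists_closedBall_subset_of_mem_interior hξ
  have hlow : ∀ x : Euc n, ‖x‖ = 1 → ∀ t ∈ {t : ℝ | ‖t • v‖ < r / 2},
      r / 2 ≤ h x - ⟪ξ + t • v, x⟫ := by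
    intro x hx t (ht : ‖t • v‖ < r / 2)
    have h1 := le_supp_sub_inner hK hsupp hr.le hrK hx
    have h2 : ⟪t • v, x⟫ ≤ r / 2 :=
      (real_inner_le_norm _ _).trans (by rw [hx, mul_one]; exact ht.le)
    rw [inner_add_left]
    linarith
  have hs : {t : ℝ | ‖t • v‖ < r / 2} ∈ 𝓝 (0 : ℝ) :=
    (isOpen_lt (by fun_prop) continuous_const).mem_nhds (by simpa using hr)
  have key := (hasDerivAt_integral_of_dominated_loc_of_deriv_le (μ := sphMeas n) (x₀ := (0 : ℝ))
    (F := fun t x => (h x - ⟪ξ + t • v, x⟫) ^ p)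
    (F' := fun t x => -p * ((h x - ⟪ξ + t • v, x⟫) ^ (p - 1) * ⟪v, x⟫))
    (bound := fun _ => |p| * ((r / 2) ^ (p - 1) * ‖v‖)) hs
    (Eventually.of_forall fun t =>
      (measurable_supp_sub_inner_rpow hcont _ p).aestronglyMeasurable)
    (by simpa using integrable_supp_sub_inner_rpow hK hcont hsupp hξ hp)
    (((measurable_supp_sub_inner_rpow hcont _ (p - 1)).mul
      (by fun_prop)).const_mul _).aestronglyMeasurable ?_ (integrable_const _) ?_).2
  · simpa using key
  · filter_upwards [ae_sphMeas_norm_eq_one n] with x hx t ht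
    have hl := hlow x hx t ht
    have hpos : 0 < h x - ⟪ξ + t • v, x⟫ := by linarith
    rw [norm_mul, norm_mul, norm_neg, norm_of_nonneg (rpow_nonneg hpos.le _)]
    have h1 := rpow_le_rpow_of_nonpos (by positivity) hl (by linarith : p - 1 ≤ 0)
    have h2 : ‖⟪v, x⟫‖ ≤ ‖v‖ := (norm_inner_le_norm v x).trans (by rw [hx, mul_one])
    exact mul_le_mul_of_nonneg_left (mul_le_mul h1 h2 (norm_nonneg _) (by positivity))
      (abs_nonneg p)
  · filter_upwards [ae_sphMeas_norm_eq_one n] with x hx t ht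
    have hl := hlow x hx t ht
    have hpos : 0 < h x - ⟪ξ + t • v, x⟫ := by linarith
    have hlin : HasDerivAt (fun t : ℝ => h x - ⟪ξ + t • v, x⟫) (-⟪v, x⟫) t := by
      have : (fun t : ℝ => h x - ⟪ξ + t • v, x⟫) = fun t => h x - (⟪ξ, x⟫ + t * ⟪v, x⟫) := by
        funext t
        rw [inner_add_left, real_inner_smul_left]
      rw [this]
      simpa using (((hasDerivAt_id t).mul_const ⟪v, x⟫).const_add ⟪ξ, x⟫).const_sub (h x)
    exact (hlin.rpow_const (p := p) (Or.inl hpos.ne')).congr_deriv (by ring)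

lemma integral_smul_eq_zero_of_isMinOn (hK : IsCompact K) (hcont : Continuous h)
    (hsupp : ∀ y, h y = sSup ((fun z => ⟪z, y⟫) '' K)) {p : ℝ} (hp : p < 0)
    {ξ : Euc n} (hξ : ξ ∈ interior K)
    (hmin : IsMinOn (fun ζ => ∫ x, (h x - ⟪ζ, x⟫) ^ p ∂(sphMeas n)) (interior K) ξ) :
    ∫ x, ((h x - ⟪ξ, x⟫) ^ (p - 1)) • x ∂(sphMeas n) = 0 := by
  have hi : Integrable (fun x => ((h x - ⟪ξ, x⟫) ^ (p - 1)) • x) (sphMeas n) := by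
    refine (integrable_supp_sub_inner_rpow hK hcont hsupp hξ (q := p - 1) (by linarith)).mono
      ((measurable_supp_sub_inner_rpow hcont ξ (p - 1)).smul measurable_id).aestronglyMeasurable ?_
    filter_upwards [ae_sphMeas_norm_eq_one n] with x hx
    rw [norm_smul, hx, mul_one]
  refine ext_inner_left ℝ fun v => ?_
  rw [← integral_inner hi, inner_zero_right]
  have hline : Continuous fun t : ℝ => ξ + t • v := by fun_prop
  have hloc : IsLocalMin (fun t : ℝ => ∫ x, (h x - ⟪ξ + t • v, x⟫) ^ p ∂(sphMeas n)) 0 := by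
    have : ∀ᶠ t : ℝ in 𝓝 0, ξ + t • v ∈ interior K :=
      hline.continuousAt.eventually_mem (isOpen_interior.mem_nhds (by simpa using hξ))
    filter_upwards [this] with t ht
    simpa using hmin ht
  have hd := hloc.hasDerivAt_eq_zero (hasDerivAt_integral_supp hK hcont hsupp hp.le hξ v)
  rw [integral_const_mul] at hd
  have := (mul_eq_zero.1 hd).resolve_left (by linarith)
  simpa only [inner_smul_right] using this

end SupportFunction

/-- For a convex body `K ⊂ ℝ^{n+1}` and `p < -n-1`, the functional
`H(ξ) = ∫_{S^n} (h_K(x) - ⟨ξ,x⟩)^p dσ` is strictly convex on `int K`, blows up at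
`∂K`, and attains its infimum at a unique interior point `ξ_K` (the
Blaschke–Santaló center), characterized by `∫ x (h_K - ⟨ξ_K,x⟩)^{p-1} dσ = 0`. -/
theorem blaschke_santalo_center (n : ℕ) (p : ℝ) (hp : p < -(n : ℝ) - 1)
    (K : Set (Euc n)) (hK : IsCompact K) (hKconv : Convex ℝ K)
    (hKint : (interior K).Nonempty) (h : Euc n → ℝ)
    (hsupp : ∀ y, h y = sSup ((fun z => ⟪z, y⟫) '' K)) :
    StrictConvexOn ℝ (interior K)
        (fun ξ => ∫ x, (h x - ⟪ξ, x⟫) ^ p ∂(sphMeas n)) ∧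
      (∀ ξ₀ ∈ frontier K,
        Tendsto (fun ξ => ∫ x, (h x - ⟪ξ, x⟫) ^ p ∂(sphMeas n))
          (𝓝[interior K] ξ₀) atTop) ∧
      (∃! ξ : Euc n, ξ ∈ interior K ∧
        IsMinOn (fun ζ => ∫ x, (h x - ⟪ζ, x⟫) ^ p ∂(sphMeas n)) (interior K) ξ ∧
        (∫ x, ((h x - ⟪ξ, x⟫) ^ (p - 1)) • x ∂(sphMeas n)) = 0) := by
  have hp' : p < -(n : ℝ) := by linarith
  have hp0 : p < 0 := hp'.trans_le (by simp)
  have hcont : Continuous h :=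
    (exists_lipschitzWith_supp hK (hKint.mono interior_subset) hsupp).choose_spec.continuous
  have hconv := strictConvexOn_integral_supp hK hKconv hcont hsupp hp0
  refine ⟨hconv, fun ξ₀ hξ₀ => tendsto_integral_supp_atTop hK hKconv hKint hsupp hp' hξ₀, ?_⟩
  obtain ⟨ξ, hξ, hmin⟩ := exists_isMinOn_integral_supp hK hKconv hKint hcont hsupp hp'
  exact ⟨ξ, ⟨hξ, hmin, integral_smul_eq_zero_of_isMinOn hK hcont hsupp hp0 hξ hmin⟩,
    fun η hη => hconv.eq_of_isMinOn hη.2.1 hmin hη.1 hξ⟩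

end
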